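/- arXiv:2410.03562 — 2 statements merged into one kernel-verified Lean document; each statement's English description precedes it below -/
import Mathlib

section
/- Let n, l, m be natural numbers and let r be an integer. Then C(n+m+r, n+r) · C(l+m, r) = Σ_{i=0}^{m} C(n+l+m+i, i) · C(n+m, n+i) · C(l, r−i). (When r < 0 both sides are zero; for r ≥ 0 the only nonzero terms on the right have i ≤ r.) -/
/-- Binomial coefficient for integer arguments, with the convention
`ibinom x k = 0` whenever `k < 0` or `k > x`. -/
def ibinom (x k : ℤ) : ℤ :=
  if 0 ≤ k ∧ k ≤ x then Nat.choose x.toNat k.toNat else 0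

theorem ibinom_natCast (x k : ℕ) : ibinom x k = x.choose k := by
  unfold ibinom
  split_ifs with h
  · simp
  · rw [Nat.choose_eq_zero_of_lt (by omega)]
    simp

theorem ibinom_of_neg (x : ℤ) {k : ℤ} (hk : k < 0) : ibinom x k = 0 := by
  unfold ibinom
  rw [if_neg (by omega)]

theorem ibinom_natCast_sub (l r i : ℕ) :
    ibinom l ((r : ℤ) - i) = ((if i ≤ r then l.choose (r - i) else 0 : ℕ) : ℤ) := by
  split_ifs with h
  · rw [← ibinom_natCast, Nat.cast_sub h]
  · rw [ibinom_of_neg _ (by omega), Nat.cast_zero]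

/-- Vandermonde's identity as a sum over a range. -/
theorem sum_range_choose_mul_choose (a b k : ℕ) :
    ∑ j ∈ Finset.range (k + 1), a.choose j * b.choose (k - j) = (a + b).choose k := by
  rw [Nat.add_choose_eq, Finset.Nat.sum_antidiagonal_eq_sum_range_succ_mk]

/-- Vandermonde's identity summed up to the upper entry of the first factor. -/
theorem sum_range_choose_mul_ite_choose (m l r : ℕ) :
    ∑ j ∈ Finset.range (m + 1), m.choose j * (if j ≤ r then l.choose (r - j) else 0) =
      (l + m).choose r := by
  rw [add_comm l m, ← sum_range_choose_mul_choose]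
  have h₁ : ∑ j ∈ Finset.range (m + 1), m.choose j * (if j ≤ r then l.choose (r - j) else 0) =
      ∑ j ∈ Finset.range (m + r + 1),
        m.choose j * (if j ≤ r then l.choose (r - j) else 0) := by
    refine Finset.sum_subset (Finset.range_mono (by omega)) fun j _ hj => ?_
    rw [Finset.mem_range] at hj
    rw [Nat.choose_eq_zero_of_lt (by omega), zero_mul]
  have h₂ : ∑ j ∈ Finset.range (r + 1), m.choose j * (if j ≤ r then l.choose (r - j) else 0) =
      ∑ j ∈ Finset.range (m + r + 1),
        m.choose j * (if j ≤ r then l.choose (r - j) else 0) := by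
    refine Finset.sum_subset (Finset.range_mono (by omega)) fun j _ hj => ?_
    rw [Finset.mem_range] at hj
    rw [if_neg (by omega), mul_zero]
  rw [h₁, ← h₂]
  refine Finset.sum_congr rfl fun j hj => ?_
  rw [Finset.mem_range] at hj
  rw [if_pos (by omega)]

theorem choose_mul_ite_choose_eq_sum (n l m r i : ℕ) :
    (n + l + m + i).choose i * (if i ≤ r then l.choose (r - i) else 0) =
      ∑ j ∈ Finset.range (i + 1), (n + m + r).choose j *
        (if j ≤ r then l.choose (r - j) else 0) * (r - j).choose (i - j) := by
  rcases lt_or_ge r i with hri | hir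
  · rw [if_neg (by omega), mul_zero]
    refine (Finset.sum_eq_zero fun j _ => ?_).symm
    split_ifs with hj
    · rw [Nat.choose_eq_zero_of_lt (show r - j < i - j by omega), mul_zero]
    · simp
  rw [if_pos hir]
  rcases lt_or_ge l (r - i) with hl | hl
  · rw [Nat.choose_eq_zero_of_lt hl, mul_zero]
    refine (Finset.sum_eq_zero fun j hj => ?_).symm
    rw [Finset.mem_range] at hj
    rw [if_pos (by omega), Nat.choose_eq_zero_of_lt (show l < r - j by omega)]
    simp
  rw [show n + l + m + i = n + m + r + (l - (r - i)) by omega, ← sum_range_choose_mul_choose,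
    Finset.sum_mul]
  refine Finset.sum_congr rfl fun j hj => ?_
  rw [Finset.mem_range] at hj
  rw [if_pos (by omega), mul_assoc, mul_assoc]
  congr 1
  rcases lt_or_ge l (r - j) with hlj | hlj
  · rw [Nat.choose_eq_zero_of_lt hlj, Nat.choose_eq_zero_of_lt (show l - (r - i) < i - j by omega)]
    simp
  have h := Nat.choose_mul (n := l) (k := r - j) (s := r - i) (by omega)
  rw [show r - j - (r - i) = i - j by omega] at h
  rw [mul_comm, ← h, ← Nat.choose_symm_of_eq_add (show r - j = r - i + (i - j) by omega)]

theorem choose_mul_choose_eq_sum (n l m r : ℕ) :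
    (n + m + r).choose (n + r) * (l + m).choose r =
      ∑ i ∈ Finset.range (m + 1), (n + l + m + i).choose i * (n + m).choose (n + i) *
        (if i ≤ r then l.choose (r - i) else 0) := by
  symm
  calc
    _ = ∑ i ∈ Finset.range (m + 1), ∑ j ∈ Finset.range (i + 1),
          (n + m + r).choose j * (if j ≤ r then l.choose (r - j) else 0) *
            (r - j).choose (i - j) * (n + m).choose (n + i) := by
      refine Finset.sum_congr rfl fun i _ => ?_
      rw [mul_right_comm, choose_mul_ite_choose_eq_sum, Finset.sum_mul]
    _ = ∑ j ∈ Finset.range (m + 1), ∑ i ∈ Finset.Ico j (m + 1),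
          (n + m + r).choose j * (if j ≤ r then l.choose (r - j) else 0) *
            (r - j).choose (i - j) * (n + m).choose (n + i) := by
      refine Finset.sum_comm' fun i j => ?_
      simp only [Finset.mem_range, Finset.mem_Ico]
      omega
    _ = ∑ j ∈ Finset.range (m + 1), (n + m + r).choose (n + r) *
          (m.choose j * (if j ≤ r then l.choose (r - j) else 0)) := by
      refine Finset.sum_congr rfl fun j hj => ?_
      rw [Finset.mem_range] at hj
      split_ifs with hjr
      · have h : ∑ i ∈ Finset.Ico j (m + 1), (r - j).choose (i - j) * (n + m).choose (n + i) =
            (n + m + r - j).choose (m - j) := by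
          rw [Finset.sum_Ico_eq_sum_range, show m + 1 - j = m - j + 1 by omega,
            show n + m + r - j = r - j + (n + m) by omega, ← sum_range_choose_mul_choose]
          refine Finset.sum_congr rfl fun k hk => ?_
          rw [Finset.mem_range] at hk
          rw [Nat.add_sub_cancel_left,
            Nat.choose_symm_of_eq_add (show n + m = n + (j + k) + (m - j - k) by omega)]
        simp only [mul_assoc]
        rw [← Finset.mul_sum, ← Finset.mul_sum, h, mul_left_comm,
          ← Nat.choose_mul (show j ≤ m by omega),
          Nat.choose_symm_of_eq_add (show n + m + r = m + (n + r) by omega)]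
        ring
      · simp
    _ = _ := by rw [← Finset.mul_sum, sum_range_choose_mul_ite_choose]

/-- For natural numbers `n, l, m` and an integer `r`,
`C(n+m+r, n+r) · C(l+m, r) = Σ_{i=0}^{m} C(n+l+m+i, i) · C(n+m, n+i) · C(l, r−i)`. -/
theorem stmt_2 (n l m : ℕ) (r : ℤ) :
    ibinom ((n : ℤ) + m + r) ((n : ℤ) + r) * ibinom ((l : ℤ) + m) r =
      ∑ i ∈ Finset.range (m + 1),
        ibinom ((n : ℤ) + l + m + i) (i : ℤ) * ibinom ((n : ℤ) + m) ((n : ℤ) + i) *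
          ibinom (l : ℤ) (r - i) := by
  rcases lt_or_ge r 0 with hr | hr
  · rw [ibinom_of_neg _ hr, mul_zero]
    refine (Finset.sum_eq_zero fun i _ => ?_).symm
    rw [ibinom_of_neg _ (show r - i < 0 by omega), mul_zero]
  · lift r to ℕ using hr
    simp only [ibinom_natCast_sub, ← Nat.cast_add, ibinom_natCast]
    exact_mod_cast choose_mul_choose_eq_sum n l m r
end

section
/- Assume the supports of α and β are offset: supp(α) ∩ supp(β) = ∅ and any two distinct elements of supp(α) ∪ supp(β) differ by at least 2t+1, where supp(α) = { j : α_j ≠ 0 } and supp(β) = { j : β_j ≠ 0 }. If moreover Σ_{j=0}^{n} ( α_j² − β_j² ) · j^i = 0 for every natural number i ≤ 2t, then α and β satisfy conditions (C3) and (C4) with t′ = 2t. (This recovers the construction strategy of absorption-emission codes with staggered basis-state supports: any solution of the moment equations with sufficiently separated supports yields a code correcting up to order-t transitions.) -/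
open Nat in
/-- Ratios of binomial coefficients as products of falling factorials. -/
theorem choose_mul_descFactorial_add (j k a b : ℕ) :
    (j + k).choose j * (j + k + (a + b)).descFactorial (a + b) =
      (j + k + (a + b)).choose (j + a) *
        ((j + a).descFactorial a * (k + b).descFactorial b) := by
  have h1 := Nat.add_choose_mul_factorial_mul_factorial j k
  rw [← Nat.choose_symm_add] at h1
  have h2 := Nat.add_choose_mul_factorial_mul_factorial (j + a) (k + b)
  rw [← Nat.choose_symm_add, show j + a + (k + b) = j + k + (a + b) by ring] at h2
  have h3 := Nat.factorial_mul_descFactorial (n := j + k + (a + b)) (k := a + b) (by omega)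
  have h4 := Nat.factorial_mul_descFactorial (n := j + a) (k := a) (by omega)
  have h5 := Nat.factorial_mul_descFactorial (n := k + b) (k := b) (by omega)
  rw [Nat.add_sub_cancel] at h3 h4 h5
  refine Nat.eq_of_mul_eq_mul_left (Nat.mul_pos j.factorial_pos k.factorial_pos) ?_
  calc j ! * k ! * ((j + k).choose j * (j + k + (a + b)).descFactorial (a + b))
      = ((j + k).choose j * j ! * k !) * (j + k + (a + b)).descFactorial (a + b) := by ring
    _ = (j + k + (a + b)).choose (j + a) * (j + a)! * (k + b)! := by rw [h1, h3, h2]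
    _ = _ := by rw [← h4, ← h5]; ring

/-- A weight whose moments of order at most `d` vanish annihilates every polynomial of degree at
most `d`. -/
theorem sum_mul_eval_eq_zero_of_moments (s : Finset ℕ) (w : ℕ → ℝ) (d : ℕ)
    (hw : ∀ i ≤ d, ∑ j ∈ s, w j * (j : ℝ) ^ i = 0) (p : Polynomial ℝ) (hp : p.natDegree ≤ d) :
    ∑ j ∈ s, w j * p.eval (j : ℝ) = 0 := by
  simp_rw [Polynomial.eval_eq_sum_range, Finset.mul_sum]
  rw [Finset.sum_comm]
  refine Finset.sum_eq_zero fun i hi => ?_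
  rw [Finset.mem_range] at hi
  simp_rw [mul_left_comm (w _)]
  rw [← Finset.mul_sum, hw i (by omega), mul_zero]

/-- If the moments of `w` of order at most `s` vanish, so do its sums against the ratios
`C(n - s, m - a) / C(n, m)`. -/
theorem sum_choose_mul_div_choose_eq_zero (n s a : ℕ) (hs : s ≤ n) (ha : a ≤ s) (w : ℕ → ℝ)
    (hw : ∀ i ≤ s, ∑ j ∈ Finset.range (n + 1), w j * (j : ℝ) ^ i = 0) :
    ∑ j ∈ Finset.range (n - s + 1),
      ((n - s).choose j : ℝ) * w (j + a) / (n.choose (j + a) : ℝ) = 0 := by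
  set p : Polynomial ℝ := descPochhammer ℝ a *
    (descPochhammer ℝ (s - a)).comp (Polynomial.C (n : ℝ) - Polynomial.X) with hp
  have hdeg : p.natDegree ≤ s := by
    refine Polynomial.natDegree_mul_le.trans ?_
    have h : (Polynomial.C (n : ℝ) - Polynomial.X).natDegree ≤ 1 := by compute_degree
    rw [Polynomial.natDegree_comp, descPochhammer_natDegree, descPochhammer_natDegree]
    have := Nat.mul_le_mul_left (s - a) h
    omega
  have heval (m : ℕ) (hm : m ≤ n) :
      p.eval (m : ℝ) = (m.descFactorial a * (n - m).descFactorial (s - a) : ℕ) := by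
    rw [hp, Polynomial.eval_mul, Polynomial.eval_comp, Polynomial.eval_sub, Polynomial.eval_C,
      Polynomial.eval_X, ← Nat.cast_sub hm, descPochhammer_eval_eq_descFactorial,
      descPochhammer_eval_eq_descFactorial, Nat.cast_mul]
  have hD : (n.descFactorial s : ℝ) ≠ 0 := by
    rw [Nat.cast_ne_zero, Ne, Nat.descFactorial_eq_zero_iff_lt]
    omega
  have key := sum_mul_eval_eq_zero_of_moments _ w s hw p hdeg
  have hshift : ∑ j ∈ Finset.range (n - s + 1), w (j + a) * p.eval ((j + a : ℕ) : ℝ) =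
      ∑ m ∈ Finset.range (n + 1), w m * p.eval (m : ℝ) := by
    refine Finset.sum_of_injOn (· + a) (add_left_injective a).injOn ?_ ?_ fun _ _ => rfl
    · intro j hj
      simp only [Finset.coe_range, Set.mem_Iio] at hj ⊢
      omega
    · intro m hm hm'
      rw [Finset.mem_range] at hm
      rw [heval m (by omega)]
      have : m < a ∨ n - m < s - a := by
        by_contra! h
        exact hm' ⟨m - a, by simp only [Finset.coe_range, Set.mem_Iio]; omega,
          by simp only; omega⟩
      rcases this with h | h <;> simp [Nat.descFactorial_eq_zero_iff_lt.2 h]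
  rw [← mul_right_inj' hD, mul_zero, Finset.mul_sum, ← key, ← hshift]
  refine Finset.sum_congr rfl fun j hj => ?_
  rw [Finset.mem_range] at hj
  obtain ⟨k, hk⟩ := Nat.exists_eq_add_of_le (show j ≤ n - s by omega)
  obtain ⟨b, rfl⟩ := Nat.exists_eq_add_of_le ha
  obtain rfl : n = j + k + (a + b) := by omega
  have hC : ((j + k + (a + b)).choose (j + a) : ℝ) ≠ 0 :=
    Nat.cast_ne_zero.2 (Nat.choose_pos (by omega)).ne'
  have h := congrArg (Nat.cast (R := ℝ)) (choose_mul_descFactorial_add j k a b)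
  rw [heval _ (by omega), show j + k + (a + b) - (j + a) = k + b by omega,
    Nat.add_sub_cancel_left, Nat.add_sub_cancel]
  push_cast at h ⊢
  field_simp
  linear_combination w (j + a) * h

/-- let `n ≥ 2t` and let `α, β : ℤ → ℝ` vanish outside `{0,…,n}`,
with offset supports: `supp(α) ∩ supp(β) = ∅` and any two distinct elements of
`supp(α) ∪ supp(β)` differ by at least `2t+1`. If moreover
`Σ_{j=0}^{n} (α_j² − β_j²) · j^i = 0` for every natural `i ≤ 2t`, then
`α` and `β` satisfy conditions (C3) and (C4) with `t′ = 2t`. -/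
theorem stmt_13 (n t : ℕ) (hn : 2 * t ≤ n) (α β : ℤ → ℝ)
    (hα : ∀ j : ℤ, j < 0 ∨ (n : ℤ) < j → α j = 0)
    (hβ : ∀ j : ℤ, j < 0 ∨ (n : ℤ) < j → β j = 0)
    (hdisj : ∀ j : ℤ, α j = 0 ∨ β j = 0)
    (hsep : ∀ j j' : ℤ, (α j ≠ 0 ∨ β j ≠ 0) → (α j' ≠ 0 ∨ β j' ≠ 0) → j ≠ j' →
      (2 * (t : ℤ) + 1) ≤ |j - j'|)
    (hmom : ∀ i : ℕ, i ≤ 2 * t →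
      ∑ j ∈ Finset.range (n + 1),
        ((α (j : ℤ)) ^ 2 - (β (j : ℤ)) ^ 2) * (j : ℝ) ^ i = 0) :
    (∀ a b : ℕ, a ≤ 2 * t → b ≤ 2 * t →
      ∑ j ∈ Finset.range (n - 2 * t + 1),
        ((n - 2 * t).choose j : ℝ) * α ((j : ℤ) + a) * β ((j : ℤ) + b) /
          Real.sqrt ((n.choose (j + a) : ℝ) * (n.choose (j + b) : ℝ)) = 0) ∧
    (∀ a b : ℕ, a ≤ 2 * t → b ≤ 2 * t →
      ∑ j ∈ Finset.range (n - 2 * t + 1),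
        ((n - 2 * t).choose j : ℝ) *
          (α ((j : ℤ) + a) * α ((j : ℤ) + b) - β ((j : ℤ) + a) * β ((j : ℤ) + b)) /
          Real.sqrt ((n.choose (j + a) : ℝ) * (n.choose (j + b) : ℝ)) = 0) := by
  have hprod {f g : ℤ → ℝ} (hf : ∀ j, f j ≠ 0 → α j ≠ 0 ∨ β j ≠ 0)
      (hg : ∀ j, g j ≠ 0 → α j ≠ 0 ∨ β j ≠ 0) (j : ℤ) {a b : ℕ} (ha : a ≤ 2 * t)
      (hb : b ≤ 2 * t) (hab : a ≠ b) : f (j + a) * g (j + b) = 0 := by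
    by_contra h
    obtain ⟨h1, h2⟩ := mul_ne_zero_iff.1 h
    have := hsep _ _ (hf _ h1) (hg _ h2) (by omega)
    rw [le_abs] at this
    omega
  refine ⟨fun a b ha hb => Finset.sum_eq_zero fun j _ => ?_, fun a b ha hb => ?_⟩
  · have : α (j + a) * β (j + b) = 0 := by
      rcases eq_or_ne a b with rfl | hab
      · exact mul_eq_zero.2 (hdisj _)
      · exact hprod (fun _ => Or.inl) (fun _ => Or.inr) j ha hb hab
    rw [mul_assoc, this, mul_zero, zero_div]
  · rcases eq_or_ne a b with rfl | hab
    · rw [← sum_choose_mul_div_choose_eq_zero n (2 * t) a hn ha _ hmom]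
      refine Finset.sum_congr rfl fun j _ => ?_
      rw [Real.sqrt_mul_self (Nat.cast_nonneg _)]
      push_cast
      ring
    · refine Finset.sum_eq_zero fun j _ => ?_
      rw [hprod (fun _ => Or.inl) (fun _ => Or.inl) j ha hb hab,
        hprod (fun _ => Or.inr) (fun _ => Or.inr) j ha hb hab, sub_zero, mul_zero, zero_div]
end
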